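/- Assume |ξ| ≠ 1/(2βη²γ). Then λ₊(ξ) and λ₋(ξ) are distinct, both are eigenvalues of the restriction of Â(ξ) to E(ξ), and for each sign ± the eigenspace of λ±(ξ) in E(ξ) is exactly {(e, −(i/(γλ±(ξ))) ξ × e) : e ∈ ℂ³, ξ · e = 0}. -/

import Mathlib

noncomputable section

open Complex

/-- ℂ³ with the Hermitian (Euclidean) norm. -/
abbrev V3 : Type := EuclideanSpace ℂ (Fin 3)
/-- ℝ³ with the Euclidean norm. -/
abbrev R3 : Type := EuclideanSpace ℝ (Fin 3)

/-- The cross product, extended ℂ-bilinearly to ℂ³. -/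
def cross (a b : V3) : V3 :=
  (WithLp.equiv 2 (Fin 3 → ℂ)).symm
    ![a 1 * b 2 - a 2 * b 1, a 2 * b 0 - a 0 * b 2, a 0 * b 1 - a 1 * b 0]

/-- The dot product, extended ℂ-bilinearly to ℂ³. -/
def dotc (a b : V3) : ℂ := a 0 * b 0 + a 1 * b 1 + a 2 * b 2

/-- The coercion of a real vector to a complex vector. -/
def toC (ξ : R3) : V3 := (WithLp.equiv 2 (Fin 3 → ℂ)).symm fun j => ((ξ j : ℝ) : ℂ)

/-- The Fourier-side Maxwell operator Â(ξ). -/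
def Ahat (β η γ : ℝ) (ξ : R3) (v : V3 × V3) : V3 × V3 :=
  (-(1 / ((β : ℂ) * (η : ℂ) ^ 2 * (γ : ℂ) ^ 2)) • v.1 + (I / (γ : ℂ)) • cross (toC ξ) v.2,
   (-(I / (γ : ℂ))) • cross (toC ξ) v.1)

/-- The eigenvalue λ₀ = −1/(βη²γ²). -/
def lam0 (β η γ : ℝ) : ℂ := -(1 / ((β : ℂ) * (η : ℂ) ^ 2 * (γ : ℂ) ^ 2))

/-- δ(ξ) = √(1 − 4β²η⁴γ²|ξ|²) if |ξ| ≤ 1/(2βη²γ), and i√(4β²η⁴γ²|ξ|² − 1) otherwise. -/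
def deltaF (β η γ : ℝ) (ξ : R3) : ℂ :=
  if ‖ξ‖ ≤ 1 / (2 * β * η ^ 2 * γ) then
    ((Real.sqrt (1 - 4 * β ^ 2 * η ^ 4 * γ ^ 2 * ‖ξ‖ ^ 2) : ℝ) : ℂ)
  else I * ((Real.sqrt (4 * β ^ 2 * η ^ 4 * γ ^ 2 * ‖ξ‖ ^ 2 - 1) : ℝ) : ℂ)

/-- λ₊(ξ) = (−1 + δ(ξ))/(2βη²γ²). -/
def lamP (β η γ : ℝ) (ξ : R3) : ℂ :=
  (-1 + deltaF β η γ ξ) / (2 * (β : ℂ) * (η : ℂ) ^ 2 * (γ : ℂ) ^ 2)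

/-- λ₋(ξ) = (−1 − δ(ξ))/(2βη²γ²). -/
def lamM (β η γ : ℝ) (ξ : R3) : ℂ :=
  (-1 - deltaF β η γ ξ) / (2 * (β : ℂ) * (η : ℂ) ^ 2 * (γ : ℂ) ^ 2)

lemma dotc_toC_self (ξ : R3) : dotc (toC ξ) (toC ξ) = ((‖ξ‖ ^ 2 : ℝ) : ℂ) := by
  rw [EuclideanSpace.norm_sq_eq, Fin.sum_univ_three]
  simp [dotc, toC]
  ring

lemma dotc_cross_self (x e : V3) : dotc x (cross x e) = 0 := by
  simp [dotc, cross]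
  ring

lemma dotc_smul (c : ℂ) (x e : V3) : dotc x (c • e) = c * dotc x e := by
  simp [dotc]
  ring

lemma dotc_add (x e f : V3) : dotc x (e + f) = dotc x e + dotc x f := by
  simp [dotc]
  ring

lemma cross_smul (c : ℂ) (x e : V3) : cross x (c • e) = c • cross x e := by
  ext i
  fin_cases i <;> simp [cross] <;> ring

lemma cross_cross_self (x e : V3) :
    cross x (cross x e) = dotc x e • x - dotc x x • e := by
  ext i
  fin_cases i <;> simp [cross, dotc] <;> ring

lemma exists_ne_zero_dotc_eq_zero (x : V3) : ∃ e : V3, e ≠ 0 ∧ dotc x e = 0 := by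
  by_cases hx : x 0 = 0
  · refine ⟨!₂[1, 0, 0], fun h => ?_, by simp [dotc, hx]⟩
    simpa using congrArg (fun v : V3 => v 0) h
  · refine ⟨!₂[-x 1, x 0, 0], fun h => hx ?_, ?_⟩
    · simpa using congrArg (fun v : V3 => v 1) h
    · simp [dotc]
      ring

lemma deltaF_sq {β η γ : ℝ} (hβ : 0 < β) (hη : 0 < η) (hγ : 0 < γ) (ξ : R3) :
    deltaF β η γ ξ ^ 2 =
      ((1 - 4 * β ^ 2 * η ^ 4 * γ ^ 2 * ‖ξ‖ ^ 2 : ℝ) : ℂ) := by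
  have hp : 0 < 2 * β * η ^ 2 * γ := by positivity
  have key : 4 * β ^ 2 * η ^ 4 * γ ^ 2 * ‖ξ‖ ^ 2 = (‖ξ‖ * (2 * β * η ^ 2 * γ)) ^ 2 := by ring
  have hn : 0 ≤ ‖ξ‖ * (2 * β * η ^ 2 * γ) := by positivity
  rw [deltaF, key]
  split_ifs with hle
  · rw [le_div_iff₀ hp] at hle
    rw [← ofReal_pow, Real.sq_sqrt (by nlinarith)]
  · rw [not_le, div_lt_iff₀ hp] at hle
    rw [mul_pow, I_sq, ← ofReal_pow, Real.sq_sqrt (by nlinarith)]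
    push_cast
    ring

lemma deltaF_ne_zero {β η γ : ℝ} (hβ : 0 < β) (hη : 0 < η) (hγ : 0 < γ) {ξ : R3}
    (h : ‖ξ‖ ≠ 1 / (2 * β * η ^ 2 * γ)) : deltaF β η γ ξ ≠ 0 := by
  intro h0
  have hsq := deltaF_sq hβ hη hγ ξ
  rw [h0, zero_pow two_ne_zero, eq_comm, ofReal_eq_zero] at hsq
  have hp : 0 < 2 * β * η ^ 2 * γ := by positivity
  refine h ((eq_div_iff hp.ne').2 ?_)
  have hn : 0 ≤ ‖ξ‖ * (2 * β * η ^ 2 * γ) := by positivity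
  exact (pow_eq_one_iff_of_nonneg hn two_ne_zero).1 (by linear_combination -hsq)

/-- Both eigenvalues are roots of `μ (μ - λ₀) = -|ξ|² / γ²`. -/
lemma mul_sub_lam0_eq {β η γ : ℝ} (hβ : 0 < β) (hη : 0 < η) (hγ : 0 < γ) {ξ : R3} {μ : ℂ}
    (hμ : μ ∈ ({lamP β η γ ξ, lamM β η γ ξ} : Set ℂ)) :
    μ * (μ - lam0 β η γ) * (γ : ℂ) ^ 2 = -dotc (toC ξ) (toC ξ) := by
  have hβ' : (β : ℂ) ≠ 0 := ofReal_ne_zero.2 hβ.ne'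
  have hη' : (η : ℂ) ≠ 0 := ofReal_ne_zero.2 hη.ne'
  have hγ' : (γ : ℂ) ≠ 0 := ofReal_ne_zero.2 hγ.ne'
  have hd := deltaF_sq hβ hη hγ ξ
  push_cast at hd
  rw [dotc_toC_self]
  push_cast
  rcases hμ with rfl | rfl
  · rw [lamP, lam0]
    field_simp
    linear_combination hd
  · rw [lamM, lam0]
    field_simp
    linear_combination hd

lemma Ahat_eq_smul_iff {β η γ : ℝ} (hγ : γ ≠ 0) {ξ : R3} (hξ : ξ ≠ 0) {μ : ℂ}
    (hμ : μ * (μ - lam0 β η γ) * (γ : ℂ) ^ 2 = -dotc (toC ξ) (toC ξ)) (e b : V3) :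
    Ahat β η γ ξ (e, b) = μ • (e, b) ↔
      dotc (toC ξ) e = 0 ∧ b = (-(I / ((γ : ℂ) * μ))) • cross (toC ξ) e := by
  have hγ' : (γ : ℂ) ≠ 0 := ofReal_ne_zero.2 hγ
  have hne : dotc (toC ξ) (toC ξ) ≠ 0 := by
    rw [dotc_toC_self]
    exact ofReal_ne_zero.2 (pow_ne_zero 2 (norm_ne_zero_iff.2 hξ))
  have hμ0 : μ ≠ 0 := by
    rintro rfl
    exact hne (by linear_combination hμ)
  have hμl : μ - lam0 β η γ ≠ 0 := by
    intro h0
    exact hne (by linear_combination hμ - μ * (γ : ℂ) ^ 2 * h0)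
  have hb : (-(I / (γ : ℂ))) • cross (toC ξ) e = μ • b ↔
      b = (-(I / ((γ : ℂ) * μ))) • cross (toC ξ) e := by
    rw [eq_comm, ← eq_inv_smul_iff₀ hμ0, smul_smul,
      show μ⁻¹ * -(I / (γ : ℂ)) = -(I / ((γ : ℂ) * μ)) by field_simp]
  change (lam0 β η γ • e + (I / (γ : ℂ)) • cross (toC ξ) b,
    (-(I / (γ : ℂ))) • cross (toC ξ) e) = (μ • e, μ • b) ↔ _
  rw [Prod.mk.injEq, hb]
  refine and_congr_left fun hbe => ⟨fun he => ?_, fun he => ?_⟩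
  · have hdot := congrArg (dotc (toC ξ)) he
    rw [dotc_add, dotc_smul, dotc_smul, dotc_smul, dotc_cross_self] at hdot
    exact (mul_eq_zero.1 (by linear_combination -hdot)).resolve_left hμl
  · have hc : I / (γ : ℂ) * (-(I / ((γ : ℂ) * μ))) * dotc (toC ξ) (toC ξ)
        = lam0 β η γ - μ := by
      field_simp
      rw [I_sq]
      linear_combination hμ
    rw [hbe, cross_smul, cross_cross_self, he, zero_smul, zero_sub, smul_neg, smul_neg,
      smul_smul, smul_smul, hc]
    module

/-- if |ξ| ≠ 1/(2βη²γ), λ₊(ξ) ≠ λ₋(ξ), both are eigenvalues of the restriction of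
Â(ξ) to E(ξ), and the eigenspace of λ± is exactly {(e, −(i/(γλ±)) ξ × e) : ξ·e = 0}. -/
theorem eigenvalues_lamP_lamM (β η γ : ℝ) (hβ : 0 < β) (hη : 0 < η) (hγ : 0 < γ)
    (ξ : R3) (hξ : ξ ≠ 0) (h : ‖ξ‖ ≠ 1 / (2 * β * η ^ 2 * γ)) :
    lamP β η γ ξ ≠ lamM β η γ ξ ∧
    ∀ μ ∈ ({lamP β η γ ξ, lamM β η γ ξ} : Set ℂ),
      (∃ v : V3 × V3, dotc (toC ξ) v.2 = 0 ∧ v ≠ 0 ∧ Ahat β η γ ξ v = μ • v) ∧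
      (∀ e b : V3, dotc (toC ξ) b = 0 →
        (Ahat β η γ ξ (e, b) = μ • (e, b) ↔
          dotc (toC ξ) e = 0 ∧ b = (-(I / ((γ : ℂ) * μ))) • cross (toC ξ) e)) := by
  refine ⟨fun heq => ?_, fun μ hμ => ?_⟩
  · have hden : 2 * (β : ℂ) * (η : ℂ) ^ 2 * (γ : ℂ) ^ 2 ≠ 0 := by
      simp [hβ.ne', hη.ne', hγ.ne']
    rw [lamP, lamM, div_left_inj' hden] at heq
    exact deltaF_ne_zero hβ hη hγ h (by linear_combination heq / 2)
  · have hiff := Ahat_eq_smul_iff hγ.ne' hξ (mul_sub_lam0_eq hβ hη hγ hμ)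
    obtain ⟨e, he0, he⟩ := exists_ne_zero_dotc_eq_zero (toC ξ)
    refine ⟨⟨(e, (-(I / ((γ : ℂ) * μ))) • cross (toC ξ) e), ?_, ?_, (hiff _ _).2 ⟨he, rfl⟩⟩,
      fun e b _ => hiff e b⟩
    · rw [dotc_smul, dotc_cross_self, mul_zero]
    · exact fun h0 => he0 (congrArg Prod.fst h0)
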